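/- arXiv:2110.15496 — 3 statements merged into one kernel-verified Lean document; each statement's English description precedes it below -/
import Mathlib

section
/- Let X be a Tychonoff (completely regular Hausdorff) topological space. Then B_1(X) is meager in itself if and only if there exists a pairwise disjoint sequence {Δ_n : n ∈ ℕ} of nonempty finite subsets of X that contains no strongly Coz_δ-disjoint subsequence. -/
open Set Topology Filter

/-- A real-valued function on a topological space is *Baire-one* if it is the
pointwise limit of a sequence of continuous real-valued functions. -/
def BaireOne {X : Type*} [TopologicalSpace X] (f : X → ℝ) : Prop :=
  ∃ g : ℕ → X → ℝ, (∀ n, Continuous (g n)) ∧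
    ∀ x, Filter.Tendsto (fun n => g n x) Filter.atTop (nhds (f x))

/-- A *zero-set* is the preimage of `{0}` under a continuous real-valued function. -/
def IsZeroSet {X : Type*} [TopologicalSpace X] (s : Set X) : Prop :=
  ∃ f : X → ℝ, Continuous f ∧ s = f ⁻¹' {0}

/-- A *cozero-set* is the complement of a zero-set. -/
def IsCozeroSet {X : Type*} [TopologicalSpace X] (s : Set X) : Prop :=
  IsZeroSet sᶜ

/-- A *Coz_δ-set* is a countable intersection of cozero-sets. -/
def IsCozDelta {X : Type*} [TopologicalSpace X] (s : Set X) : Prop :=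
  ∃ F : ℕ → Set X, (∀ n, IsCozeroSet (F n)) ∧ s = ⋂ n, F n

/-- A *Zer_σ-set* is a countable union of zero-sets. -/
def IsZerSigma {X : Type*} [TopologicalSpace X] (s : Set X) : Prop :=
  ∃ F : ℕ → Set X, (∀ n, IsZeroSet (F n)) ∧ s = ⋃ n, F n

/-- A family of Coz_δ-subsets is *completely Coz_δ-additive* if the union of every
subfamily is a Coz_δ-set. -/
def CompletelyCozDeltaAdditive {X : Type*} [TopologicalSpace X] {ι : Type*}
    (F : ι → Set X) : Prop :=
  (∀ i, IsCozDelta (F i)) ∧ ∀ S : Set ι, IsCozDelta (⋃ i ∈ S, F i)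

/-- A set `A ⊆ X` is *strongly Coz_δ-disjoint* if there is a pairwise disjoint,
completely Coz_δ-additive family of Coz_δ-sets `F a` with `a ∈ F a` for every `a ∈ A`. -/
def StronglyCozDeltaDisjoint {X : Type*} [TopologicalSpace X] (A : Set X) : Prop :=
  ∃ F : A → Set X, (∀ a : A, (a : X) ∈ F a) ∧
    (Pairwise fun a b : A => Disjoint (F a) (F b)) ∧
    CompletelyCozDeltaAdditive F

section ZeroSets

variable {X : Type*} [TopologicalSpace X]

theorem isCozeroSet_ne {f : X → ℝ} (hf : Continuous f) : IsCozeroSet {x | f x ≠ 0} :=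
  ⟨f, hf, by ext x; simp⟩

theorem IsCozeroSet.exists_eq {s : Set X} (hs : IsCozeroSet s) :
    ∃ f : X → ℝ, Continuous f ∧ s = {x | f x ≠ 0} := by
  obtain ⟨f, hf, h⟩ := hs
  refine ⟨f, hf, ?_⟩
  rw [← compl_compl s, h]
  rfl

theorem isCozeroSet_lt {f : X → ℝ} (hf : Continuous f) (r : ℝ) : IsCozeroSet {x | f x < r} := by
  convert isCozeroSet_ne (f := fun x => max 0 (r - f x)) (by fun_prop) using 1
  ext x
  simp only [mem_ofPred_eq]
  constructor
  · intro h
    rw [max_eq_right (by linarith)]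
    linarith
  · intro h
    by_contra h'
    exact h (max_eq_left (by linarith))

theorem IsCozeroSet.iUnion {s : ℕ → Set X} (hs : ∀ n, IsCozeroSet (s n)) :
    IsCozeroSet (⋃ n, s n) := by
  choose f hf hsf using fun n => (hs n).exists_eq
  have hbound : ∀ n x, ‖(1 / 2 : ℝ) ^ n * min 1 |f n x|‖ ≤ (1 / 2 : ℝ) ^ n := by
    intro n x
    rw [Real.norm_eq_abs, abs_of_nonneg (by positivity)]
    exact mul_le_of_le_one_right (by positivity) (min_le_left _ _)
  have hcont : Continuous fun x => ∑' n, (1 / 2 : ℝ) ^ n * min 1 |f n x| :=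
    continuous_tsum (fun n => by have := hf n; fun_prop) summable_geometric_two hbound
  convert isCozeroSet_ne hcont using 1
  ext x
  have hsum : Summable fun n => (1 / 2 : ℝ) ^ n * min 1 |f n x| :=
    Summable.of_norm_bounded summable_geometric_two fun n => hbound n x
  have hnonneg : ∀ n, 0 ≤ (1 / 2 : ℝ) ^ n * min 1 |f n x| := fun n => by positivity
  have hzero : (∑' n, (1 / 2 : ℝ) ^ n * min 1 |f n x|) = 0 ↔ ∀ n, f n x = 0 := by
    rw [← hsum.hasSum_iff, hasSum_zero_iff_of_nonneg hnonneg, funext_iff]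
    refine forall_congr' fun n => ?_
    constructor
    · intro h
      by_contra hne
      have : 0 < (1 / 2 : ℝ) ^ n * min 1 |f n x| := by positivity
      exact this.ne' h
    · intro h
      simp [h]
  rw [mem_ofPred_eq, Ne, hzero]
  simp [hsf]

theorem IsCozeroSet.exists_eq_iUnion {s : Set X} (hs : IsCozeroSet s) :
    ∃ f : ℕ → X → ℝ, (∀ n, Continuous (f n)) ∧ ∀ x, x ∈ s ↔ ∃ n, f n x = 0 := by
  obtain ⟨f, hf, rfl⟩ := hs.exists_eq
  refine ⟨fun n x => max 0 (1 / (n + 1 : ℝ) - |f x|), fun n => by fun_prop, fun x => ?_⟩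
  simp only [mem_ofPred_eq]
  constructor
  · intro h
    obtain ⟨n, hn⟩ := exists_nat_one_div_lt (abs_pos.2 h)
    exact ⟨n, max_eq_left (by linarith)⟩
  · rintro ⟨n, hn⟩ h0
    have : (0 : ℝ) < 1 / (n + 1 : ℝ) := by positivity
    rw [h0, abs_zero, sub_zero, max_eq_right this.le] at hn
    exact this.ne' hn

theorem IsCozDelta.iInter {ι : Type*} [Countable ι] [Nonempty ι] {s : ι → Set X}
    (hs : ∀ i, IsCozeroSet (s i)) : IsCozDelta (⋂ i, s i) := by
  obtain ⟨e, he⟩ := exists_surjective_nat ι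
  exact ⟨fun n => s (e n), fun n => hs _, (he.iInter_comp s).symm⟩

theorem IsCozDelta.exists_compl {s : Set X} (hs : IsCozDelta s) :
    ∃ f : ℕ → X → ℝ, (∀ n, Continuous (f n)) ∧ ∀ x, x ∉ s ↔ ∃ n, f n x = 0 := by
  obtain ⟨F, hF, rfl⟩ := hs
  choose f hf hFf using fun n => (hF n).exists_eq
  exact ⟨f, hf, fun x => by simp [hFf]⟩

theorem isCozDelta_empty : IsCozDelta (∅ : Set X) :=
  ⟨fun _ => ∅, fun _ => ⟨fun _ => 0, continuous_const, by ext; simp⟩, (iInter_const _).symm⟩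

theorem BaireOne.isCozDelta_preimage {f : X → ℝ} (hf : BaireOne f) {C : Set ℝ}
    (hC : IsClosed C) : IsCozDelta (f ⁻¹' C) := by
  rcases C.eq_empty_or_nonempty with rfl | hne
  · simpa using isCozDelta_empty
  obtain ⟨g, hg, hlim⟩ := hf
  have hcoz : ∀ p : ℕ × ℕ, IsCozeroSet
      (⋃ j : ℕ, {x | Metric.infDist (g (p.2 + j) x) C < 1 / (p.1 + 1 : ℝ)}) := fun p =>
    IsCozeroSet.iUnion fun j =>
      isCozeroSet_lt ((Metric.continuous_infDist_pt C).comp (hg _)) _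
  convert IsCozDelta.iInter hcoz using 1
  ext x
  have hdist : Tendsto (fun n => Metric.infDist (g n x) C) atTop
      (𝓝 (Metric.infDist (f x) C)) :=
    ((Metric.continuous_infDist_pt C).tendsto _).comp (hlim x)
  rw [mem_preimage, hC.mem_iff_infDist_zero hne]
  simp only [mem_iInter, mem_iUnion, mem_ofPred_eq, Prod.forall]
  constructor
  · intro h0 k n
    rw [h0] at hdist
    have hk : (0 : ℝ) < 1 / (k + 1 : ℝ) := by positivity
    obtain ⟨m, hm, hnm⟩ :=
      ((hdist.eventually (gt_mem_nhds hk)).and (eventually_ge_atTop n)).exists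
    exact ⟨m - n, by rwa [Nat.add_sub_cancel' hnm]⟩
  · intro h
    by_contra hne0
    have hpos : 0 < Metric.infDist (f x) C :=
      lt_of_le_of_ne Metric.infDist_nonneg (Ne.symm hne0)
    obtain ⟨k, hk⟩ := exists_nat_one_div_lt hpos
    obtain ⟨n, hn⟩ := eventually_atTop.1 (hdist.eventually (lt_mem_nhds hk))
    obtain ⟨j, hj⟩ := h k n
    exact lt_asymm hj (hn _ (Nat.le_add_right _ _))

/-- If `f` is injective on `A` with discrete closed image in the strong sense that all subsets of
`A` have closed images, then `A` is strongly Coz_δ-disjoint. -/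
theorem BaireOne.stronglyCozDeltaDisjoint {f : X → ℝ} (hf : BaireOne f) {A : Set X}
    (hinj : InjOn f A) (hclosed : ∀ S ⊆ A, IsClosed (f '' S)) : StronglyCozDeltaDisjoint A := by
  refine ⟨fun a => f ⁻¹' {f a}, fun a => rfl, fun a b hab => ?_, fun a => ?_, fun S => ?_⟩
  · refine Set.disjoint_left.2 ?_
    rintro x (hxa : f x = f a) (hxb : f x = f b)
    exact hab (Subtype.ext (hinj a.2 b.2 (hxa.symm.trans hxb)))
  · exact hf.isCozDelta_preimage isClosed_singleton
  · convert hf.isCozDelta_preimage (hclosed (Subtype.val '' S) (by simp)) using 1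
    ext x
    simp [eq_comm]

theorem baireOne_of_continuous {f : X → ℝ} (hf : Continuous f) : BaireOne f :=
  ⟨fun _ => f, fun _ => hf, fun _ => tendsto_const_nhds⟩

theorem BaireOne.add {f g : X → ℝ} (hf : BaireOne f) (hg : BaireOne g) :
    BaireOne fun x => f x + g x := by
  obtain ⟨u, hu, hfu⟩ := hf
  obtain ⟨v, hv, hgv⟩ := hg
  exact ⟨fun n x => u n x + v n x, fun n => (hu n).add (hv n), fun x => (hfu x).add (hgv x)⟩

/-- Gluing continuous functions along the first member of a sequence of zero-sets. -/
theorem baireOne_of_first_zero {φ v : ℕ → X → ℝ} (hφ : ∀ i, Continuous (φ i))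
    (hv : ∀ i, Continuous (v i)) (idx : X → ℕ) (hzero : ∀ x, φ (idx x) x = 0)
    (hfirst : ∀ x, ∀ i < idx x, φ i x ≠ 0) : BaireOne fun x => v (idx x) x := by
  set u : ℕ → ℕ → X → ℝ := fun i j x => max 0 (1 - j * |φ i x|) with hu
  have hu_cont : ∀ i j, Continuous (u i j) := fun i j => by have := hφ i; fun_prop
  refine ⟨fun j x => ∑ i ∈ Finset.range j, v i x * u i j x * ∏ k ∈ Finset.range i, (1 - u k j x),
    fun j => ?_, fun x => ?_⟩
  · exact continuous_finsetSum _ fun i _ => ((hv i).mul (hu_cont i j)).mul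
      (continuous_finsetProd _ fun k _ => continuous_const.sub (hu_cont k j))
  · have hone : ∀ j, u (idx x) j x = 1 := fun j => by simp [hu, hzero x]
    have hlarge : ∀ i ∈ Finset.range (idx x), ∀ᶠ j : ℕ in atTop, u i j x = 0 := by
      intro i hi
      have hpos : 0 < |φ i x| := abs_pos.2 (hfirst x i (Finset.mem_range.1 hi))
      have := (tendsto_natCast_atTop_atTop (R := ℝ)).atTop_mul_const hpos
      filter_upwards [this.eventually_ge_atTop 1] with j hj
      exact max_eq_left (by linarith)
    refine tendsto_const_nhds.congr' ?_
    filter_upwards [(Filter.eventually_all_finset _).2 hlarge, eventually_gt_atTop (idx x)]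
      with j hj hjx
    rw [Finset.sum_eq_single_of_mem (idx x) (Finset.mem_range.2 hjx)]
    · rw [hone, Finset.prod_eq_one fun k hk => by rw [hj k hk, sub_zero]]
      simp
    · intro i _ hne
      rcases lt_or_gt_of_ne hne with h | h
      · simp [hj i (Finset.mem_range.2 h)]
      · rw [Finset.prod_eq_zero (Finset.mem_range.2 h) (by rw [hone, sub_self]), mul_zero]

end ZeroSets

/-- On a countable strongly Coz_δ-disjoint set the choice among countably many continuous functions
can be prescribed by the values of a selector `g`, in such a way that `g` takes the value `t b` only
outside a given zero-set `{x | ψ b x = 0}` not containing `b`. -/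
theorem StronglyCozDeltaDisjoint.exists_selector {X : Type*} [TopologicalSpace X] {A : Set X}
    (hA : StronglyCozDeltaDisjoint A) (hcount : A.Countable) (hne : A.Nonempty) (t : X → ℕ)
    {ψ : X → X → ℝ} (hψ : ∀ b ∈ A, Continuous (ψ b)) (hψb : ∀ b ∈ A, ψ b b ≠ 0)
    {u : ℕ → X → ℝ} (hu : ∀ i, Continuous (u i)) :
    ∃ g : X → ℕ, BaireOne (fun x => u (g x) x) ∧ (∀ b ∈ A, g b = t b) ∧
      ∀ x, g x = 0 ∨ ∃ b ∈ A, g x = t b ∧ ψ b x ≠ 0 := by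
  obtain ⟨F, hmem, hdisj, -, hadd⟩ := hA
  have : Countable A := hcount.to_subtype
  have : Nonempty A := hne.to_subtype
  choose q hq hqF using fun b : A => (hadd {b}ᶜ).exists_compl
  choose r hr hrψ using fun b : A => (isCozeroSet_ne (hψ b b.2)).exists_eq_iUnion
  let φ : A × ℕ × Option ℕ → X → ℝ := fun p x =>
    |q p.1 p.2.1 x| + |p.2.2.elim (ψ p.1 x) fun i => r p.1 i x|
  let lab : A × ℕ × Option ℕ → ℕ := fun p => p.2.2.elim 0 fun _ => t p.1
  have hφ : ∀ p, Continuous (φ p) := by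
    rintro ⟨b, j, _ | i⟩
    · exact (hq b j).abs.add (hψ b b.2).abs
    · exact (hq b j).abs.add (hr b i).abs
  have hφ_zero : ∀ p x, φ p x = 0 ↔
      q p.1 p.2.1 x = 0 ∧ (p.2.2.elim (ψ p.1 x) fun i => r p.1 i x) = 0 := fun p x => by
    simp only [φ]
    rw [add_eq_zero_iff_of_nonneg (abs_nonneg _) (abs_nonneg _), abs_eq_zero, abs_eq_zero]
  obtain ⟨e, he⟩ := exists_surjective_nat (A × ℕ × Option ℕ)
  have hcover : ∀ x, ∃ n, φ (e n) x = 0 := by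
    intro x
    have hb : ∃ b : A, x ∉ ⋃ a ∈ ({b}ᶜ : Set A), F a := by
      by_cases hx : ∃ b, x ∈ F b
      · obtain ⟨b, hb⟩ := hx
        refine ⟨b, ?_⟩
        simp only [mem_iUnion, not_exists]
        exact fun a ha hxa => Set.disjoint_left.1 (hdisj ha) hxa hb
      · push Not at hx
        refine ⟨Classical.arbitrary A, ?_⟩
        simp only [mem_iUnion, not_exists]
        exact fun a _ => hx a
    obtain ⟨b, hb⟩ := hb
    obtain ⟨j, hj⟩ := (hqF b x).1 hb
    by_cases hx : ψ b x = 0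
    · obtain ⟨n, hn⟩ := he (b, j, none)
      exact ⟨n, (hφ_zero _ _).2 (by rw [hn]; exact ⟨hj, hx⟩)⟩
    · obtain ⟨i, hi⟩ := (hrψ b x).1 hx
      obtain ⟨n, hn⟩ := he (b, j, some i)
      exact ⟨n, (hφ_zero _ _).2 (by rw [hn]; exact ⟨hj, hi⟩)⟩
  classical
  let idx : X → ℕ := fun x => Nat.find (hcover x)
  have hidx : ∀ x, φ (e (idx x)) x = 0 := fun x => Nat.find_spec (hcover x)
  refine ⟨fun x => lab (e (idx x)), ?_, ?_, ?_⟩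
  · exact baireOne_of_first_zero (φ := fun n => φ (e n)) (v := fun n => u (lab (e n)))
      (fun n => hφ _) (fun n => hu _) idx hidx fun x i hi => Nat.find_min (hcover x) hi
  · intro b hbA
    have h := (hφ_zero _ _).1 (hidx b)
    show lab (e (idx b)) = t b
    generalize e (idx b) = p at h
    obtain ⟨a, j, o⟩ := p
    have hab : a = ⟨b, hbA⟩ := by
      by_contra hne
      refine (hqF a b).2 ⟨j, h.1⟩ ?_
      simp only [mem_iUnion]
      exact ⟨⟨b, hbA⟩, fun h' => hne h'.symm, hmem ⟨b, hbA⟩⟩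
    subst hab
    cases o with
    | none => exact absurd h.2 (hψb b hbA)
    | some i => rfl
  · intro x
    have h := (hφ_zero _ _).1 (hidx x)
    show lab (e (idx x)) = 0 ∨ ∃ b ∈ A, lab (e (idx x)) = t b ∧ ψ b x ≠ 0
    generalize e (idx x) = p at h
    obtain ⟨a, j, o⟩ := p
    cases o with
    | none => exact Or.inl rfl
    | some i => exact Or.inr ⟨a, a.2, rfl, (hrψ a x).2 ⟨i, h.2⟩⟩

section Interpolation

variable {X : Type*} [TopologicalSpace X] [T35Space X]

theorem exists_continuous_eq_on_finset (K : Finset X) (c : X → ℝ) :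
    ∃ h : X → ℝ, Continuous h ∧ ∀ x ∈ K, h x = c x := by
  classical
  have hsep : ∀ x : X, ∃ p : X → ℝ, Continuous p ∧ p x = 1 ∧ ∀ y ∈ K, y ≠ x → p y = 0 := by
    intro x
    obtain ⟨f, hf, hfx, hfK⟩ := CompletelyRegularSpace.completely_regular x
      (↑(K.erase x) : Set X) (K.erase x).finite_toSet.isClosed (by simp)
    refine ⟨fun y => 1 - (f y : ℝ), by fun_prop, by simp [hfx], fun y hy hne => ?_⟩
    have : f y = 1 := hfK (by simp [hy, hne])
    simp [this]
  choose p hp hp1 hp0 using hsep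
  refine ⟨fun y => ∑ x ∈ K, c x * p x y, continuous_finsetSum _ fun x _ =>
    continuous_const.mul (hp x), fun y hy => ?_⟩
  show ∑ x ∈ K, c x * p x y = c y
  rw [Finset.sum_eq_single_of_mem y hy, hp1, mul_one]
  intro x _ hne
  rw [hp0 x y hy hne.symm, mul_zero]

theorem exists_boundedContinuous_eq_on_finset (K : Finset X) (c : X → ℝ) {M : ℝ} (hM : 0 ≤ M)
    (hc : ∀ x ∈ K, |c x| ≤ M) :
    ∃ h : BoundedContinuousFunction X ℝ, ‖h‖ ≤ M ∧ ∀ x ∈ K, h x = c x := by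
  obtain ⟨h, hh, hK⟩ := exists_continuous_eq_on_finset K c
  have hbound : ∀ x, ‖max (-M) (min M (h x))‖ ≤ M := fun x =>
    abs_le.2 ⟨le_max_left _ _, max_le (by linarith) (min_le_left _ _)⟩
  refine ⟨BoundedContinuousFunction.ofNormedAddCommGroup (fun x => max (-M) (min M (h x)))
    (by fun_prop) M hbound, (BoundedContinuousFunction.norm_le hM).2 hbound, fun x hx => ?_⟩
  obtain ⟨h1, h2⟩ := abs_le.1 (hc x hx)
  show max (-M) (min M (h x)) = c x
  rw [hK x hx, min_eq_right h2, max_eq_right h1]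

end Interpolation

section BaireOneSpace

variable {X : Type*} [TopologicalSpace X]

theorem exists_finset_forall_abs_lt {f : {f : X → ℝ // BaireOne f}}
    {O : Set {f : X → ℝ // BaireOne f}} (hO : O ∈ 𝓝 f) :
    ∃ K : Finset X, ∃ δ > 0, ∀ f' : {f : X → ℝ // BaireOne f},
      (∀ x ∈ K, |f'.1 x - f.1 x| < δ) → f' ∈ O := by
  obtain ⟨V, hV, hVO⟩ := mem_nhds_subtype _ _ _ |>.1 hO
  rw [nhds_pi, Filter.mem_pi] at hV
  obtain ⟨I, hI, s, hs, hsV⟩ := hV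
  choose δ hδ hball using fun x => Metric.mem_nhds_iff.1 (hs x)
  obtain ⟨ε, hε, hεδ⟩ : ∃ ε > 0, ∀ x ∈ I, ε ≤ δ x := by
    have := (Filter.eventually_all_finite hI).2 fun x (_ : x ∈ I) =>
      eventually_nhdsWithin_of_eventually_nhds (s := Ioi (0 : ℝ)) (eventually_le_nhds (hδ x))
    obtain ⟨ε, h1, h2⟩ := (this.and self_mem_nhdsWithin).exists
    exact ⟨ε, h2, h1⟩
  refine ⟨hI.toFinset, ε, hε, fun f' hf' => hVO (hsV fun x hx => hball x ?_)⟩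
  rw [Metric.mem_ball, Real.dist_eq]
  exact (hf' x (hI.mem_toFinset.2 hx)).trans_le (hεδ x hx)

theorem isOpen_forall_mem_finset {K : Finset X} {V : X → Set ℝ} (hV : ∀ x, IsOpen (V x)) :
    IsOpen {f : {f : X → ℝ // BaireOne f} | ∀ x ∈ K, f.1 x ∈ V x} := by
  have : {f : {f : X → ℝ // BaireOne f} | ∀ x ∈ K, f.1 x ∈ V x} =
      ⋂ x ∈ K, (fun f : {f : X → ℝ // BaireOne f} => f.1 x) ⁻¹' V x := by
    ext; simp
  rw [this]
  exact isOpen_biInter_finset fun x _ =>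
    (hV x).preimage ((continuous_apply x).comp continuous_subtype_val)

/-- A set of Baire-one functions is dense as soon as every Baire-one function can be moved into it
by a continuous perturbation that is small on a prescribed finite set. -/
theorem dense_of_exists_add {O : Set {f : X → ℝ // BaireOne f}}
    (h : ∀ f : X → ℝ, BaireOne f → ∀ K : Finset X, ∀ δ > 0, ∃ p : X → ℝ, Continuous p ∧
      (∀ x ∈ K, |p x| < δ) ∧ ∀ f' : {f : X → ℝ // BaireOne f}, (∀ x, f'.1 x = f x + p x) → f' ∈ O) :
    Dense O := by
  intro f
  rw [mem_closure_iff_nhds]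
  intro V hV
  obtain ⟨K, δ, hδ, hKV⟩ := exists_finset_forall_abs_lt hV
  obtain ⟨p, hp, hpK, hpO⟩ := h f.1 f.2 K δ hδ
  refine ⟨⟨fun x => f.1 x + p x, f.2.add (baireOne_of_continuous hp)⟩, hKV _ fun x hx => ?_,
    hpO _ fun x => rfl⟩
  simpa using hpK x hx

end BaireOneSpace

theorem isMeagre_of_no_stronglyCozDeltaDisjoint {X : Type*} [TopologicalSpace X] [T35Space X]
    {Δ : ℕ → Set X} (hfin : ∀ n, (Δ n).Finite)
    (hdisj : Pairwise fun n m => Disjoint (Δ n) (Δ m))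
    (hΔ : ∀ φ : ℕ → ℕ, StrictMono φ → ¬ StronglyCozDeltaDisjoint (⋃ k, Δ (φ k))) :
    IsMeagre (Set.univ : Set {f : X → ℝ // BaireOne f}) := by
  classical
  set D : Set X := ⋃ n, Δ n with hD
  have hDcount : D.Countable := countable_iUnion fun n => (hfin n).countable
  have : Countable D := hDcount.to_subtype
  have hlarge : ∀ n : ℕ, ∀ᶠ f in residual {f : X → ℝ // BaireOne f},
      ∃ m ≥ n, ∀ x ∈ Δ m, (m : ℝ) < f.1 x := by
    intro n
    refine residual_of_dense_open ?_ ?_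
    · have : {f : {f : X → ℝ // BaireOne f} | ∃ m ≥ n, ∀ x ∈ Δ m, (m : ℝ) < f.1 x} =
          ⋃ m ≥ n, {f | ∀ x ∈ (hfin m).toFinset, f.1 x ∈ Ioi (m : ℝ)} := by
        ext; simp
      rw [this]
      exact isOpen_biUnion fun m _ => isOpen_forall_mem_finset fun _ => isOpen_Ioi
    · refine dense_of_exists_add fun f _ K δ hδ => ?_
      obtain ⟨m, hmn, hmK⟩ : ∃ m ≥ n, ∀ x ∈ K, x ∉ Δ m := by
        have : ∀ x ∈ K, ∀ᶠ m in atTop, x ∉ Δ m := by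
          intro x _
          by_cases hx : ∃ m, x ∈ Δ m
          · obtain ⟨m, hm⟩ := hx
            filter_upwards [eventually_gt_atTop m] with k hk hxk
            exact Set.disjoint_left.1 (hdisj hk.ne) hm hxk
          · push Not at hx
            exact Eventually.of_forall hx
        obtain ⟨m, h1, h2⟩ :=
          (((Filter.eventually_all_finset K).2 this).and (eventually_ge_atTop n)).exists
        exact ⟨m, h2, h1⟩
      obtain ⟨p, hp, hpK⟩ := exists_continuous_eq_on_finset (K ∪ (hfin m).toFinset)
        fun x => if x ∈ Δ m then m + 1 - f x else 0
      refine ⟨p, hp, fun x hx => ?_, fun f' hf' => ⟨m, hmn, fun x hx => ?_⟩⟩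
      · rw [hpK x (Finset.mem_union_left _ hx), if_neg (hmK x hx)]
        simpa using hδ
      · rw [hf', hpK x (Finset.mem_union_right _ ((hfin m).mem_toFinset.2 hx)), if_pos hx]
        linarith
  have hne : ∀ p : {p : D × D // p.1 ≠ p.2}, ∀ᶠ f in residual {f : X → ℝ // BaireOne f},
      f.1 p.1.1 ≠ f.1 p.1.2 := by
    rintro ⟨⟨a, b⟩, hab⟩
    refine residual_of_dense_open ?_ ?_
    · exact isOpen_ne_fun ((continuous_apply (a : X)).comp continuous_subtype_val)
        ((continuous_apply (b : X)).comp continuous_subtype_val)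
    · refine dense_of_exists_add fun f _ K δ hδ => ?_
      obtain ⟨p, hp, hpK⟩ := exists_continuous_eq_on_finset (K ∪ {(a : X), (b : X)})
        fun x => if x = a ∧ f a = f b then δ / 2 else 0
      refine ⟨p, hp, fun x hx => ?_, fun f' hf' => ?_⟩
      · rw [hpK x (Finset.mem_union_left _ hx)]
        split_ifs
        · rw [abs_of_pos (by linarith)]
          linarith
        · simpa using hδ
      · have hba : ¬ ((b : X) = a) := fun h => hab (Subtype.ext h.symm)
        show f'.1 a ≠ f'.1 b
        have hb0 : p b = 0 := by rw [hpK b (by simp), if_neg (fun h => hba h.1)]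
        rw [hf', hf', hb0, hpK a (by simp), add_zero]
        by_cases h : f a = f b
        · rw [if_pos ⟨rfl, h⟩, h]
          intro h'
          linarith
        · rwa [if_neg (fun h' => h h'.2), add_zero]
  rw [IsMeagre, compl_univ]
  filter_upwards [eventually_countable_forall.2 hlarge, eventually_countable_forall.2 hne]
    with f hf hfinj
  exfalso
  obtain ⟨φ, hφ, hφf⟩ := extraction_of_frequently_atTop
    (P := fun m : ℕ => ∀ x ∈ Δ m, (m : ℝ) < f.1 x) (frequently_atTop.2 hf)
  refine hΔ φ hφ (f.2.stronglyCozDeltaDisjoint (fun x hx y hy hxy => ?_) fun S hS => ?_)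
  · by_contra h
    have hsub : (⋃ k, Δ (φ k)) ⊆ D := iUnion_subset fun k => subset_iUnion Δ (φ k)
    exact hfinj ⟨⟨⟨x, hsub hx⟩, ⟨y, hsub hy⟩⟩, fun h' => h (congrArg Subtype.val h')⟩ hxy
  · have : f.1 '' S = ⋃ k, f.1 '' (S ∩ Δ (φ k)) := by
      rw [← image_iUnion, ← inter_iUnion, inter_eq_left.2 hS]
    rw [this]
    refine LocallyFinite.isClosed_iUnion (fun y => ?_) fun k =>
      (((hfin _).inter_of_right S).image _).isClosed
    obtain ⟨N, hN⟩ := exists_nat_gt y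
    refine ⟨Iio N, Iio_mem_nhds hN, (finite_lt_nat N).subset ?_⟩
    rintro k ⟨z, ⟨x, hx, rfl⟩, hz⟩
    have h1 : (φ k : ℝ) < N := (hφf k x hx.2).trans hz
    exact (hφ.le_apply (x := k)).trans_lt (by exact_mod_cast h1)

theorem countable_finset_coe_subset {X : Type*} {A : Set X} (hA : A.Countable) :
    {K : Finset X | (K : Set X) ⊆ A}.Countable := by
  refine ((countable_ofPred_finite_subset hA).preimage (f := fun K : Finset X => (K : Set X))
    Finset.coe_injective).mono fun K hK => ?_
  exact ⟨K.finite_toSet, hK⟩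

theorem exists_countable_closed_under {X : Type*} (F : Finset X → Set X)
    (hF : ∀ K, (F K).Countable) :
    ∃ A : Set X, A.Countable ∧ ∀ K : Finset X, (K : Set X) ⊆ A → F K ⊆ A := by
  let S : ℕ → Set X := fun n => Nat.rec ∅
    (fun _ T => T ∪ ⋃ K ∈ {K : Finset X | (K : Set X) ⊆ T}, F K) n
  have hS : ∀ n, S (n + 1) = S n ∪ ⋃ K ∈ {K : Finset X | (K : Set X) ⊆ S n}, F K := fun n => rfl
  have hmono : Monotone S := monotone_nat_of_le_succ fun n => by
    rw [hS]
    exact subset_union_left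
  refine ⟨⋃ n, S n, countable_iUnion fun n => ?_, fun K hK => ?_⟩
  · induction n with
    | zero => exact countable_empty
    | succ n ih =>
      rw [hS]
      refine ih.union (Countable.biUnion (countable_finset_coe_subset ih) fun K _ => hF K)
  · obtain ⟨n, hn⟩ := hmono.directed_le.exists_mem_subset_of_finset_subset_biUnion hK
    exact (subset_iUnion_of_subset (n + 1) (by
      rw [hS]
      exact subset_union_of_subset_right (subset_biUnion_of_mem (u := F) hn) _))

section Generic

variable {X : Type*} [TopologicalSpace X]

/-- The set `O` contains all Baire-one functions sufficiently close to `c` on the finite set `K`. -/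
def ContainsBox (O : Set {f : X → ℝ // BaireOne f}) (K : Finset X) (c : X → ℝ) : Prop :=
  ∃ δ > 0, ∀ f : {f : X → ℝ // BaireOne f}, (∀ x ∈ K, |f.1 x - c x| < δ) → f ∈ O

theorem ContainsBox.mono {O : Set {f : X → ℝ // BaireOne f}} {K K' : Finset X} {c c' : X → ℝ}
    (h : ContainsBox O K c) (hK : K ⊆ K') (hc : ∀ x ∈ K, c' x = c x) : ContainsBox O K' c' := by
  obtain ⟨δ, hδ, hO⟩ := h
  exact ⟨δ, hδ, fun f hf => hO f fun x hx => by rw [← hc x hx]; exact hf x (hK hx)⟩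

variable [T35Space X]

theorem exists_containsBox {O : Set {f : X → ℝ // BaireOne f}} (hO : IsOpen O) (hd : Dense O)
    (K : Finset X) (c : X → ℝ) {ε : ℝ} (hε : 0 < ε) :
    ∃ K' : Finset X, K ⊆ K' ∧ ∃ c' : X → ℝ, (∀ x ∈ K, |c' x - c x| < ε) ∧ ContainsBox O K' c' := by
  classical
  obtain ⟨h, hh, hK⟩ := exists_continuous_eq_on_finset K c
  have hopen := isOpen_forall_mem_finset (K := K) (V := fun x => Metric.ball (c x) ε)
    fun _ => Metric.isOpen_ball
  obtain ⟨f, hf, hfO⟩ := hd.inter_open_nonempty _ hopen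
    ⟨⟨h, baireOne_of_continuous hh⟩, fun x hx => by
      show h x ∈ _
      rw [hK x hx]
      exact Metric.mem_ball_self hε⟩
  obtain ⟨K₀, δ, hδ, hK₀⟩ := exists_finset_forall_abs_lt (hO.mem_nhds hfO)
  refine ⟨K ∪ K₀, Finset.subset_union_left, f.1, fun x hx => hf x hx, δ, hδ, fun f' hf' => ?_⟩
  exact hK₀ f' fun x hx => hf' x (Finset.mem_union_right _ hx)

theorem exists_countable_containsBox {U : ℕ → Set {f : X → ℝ // BaireOne f}}
    (hU : ∀ n, IsOpen (U n)) (hd : ∀ n, Dense (U n)) :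
    ∃ A : Set X, A.Countable ∧ ∀ n, ∀ K : Finset X, (K : Set X) ⊆ A → ∀ c : X → ℝ, ∀ ε > 0,
      ∃ K' : Finset X, K ⊆ K' ∧ (K' : Set X) ⊆ A ∧ ∃ c' : X → ℝ, (∀ x ∈ K, |c' x - c x| < ε) ∧
        ContainsBox (U n) K' c' := by
  classical
  let ext : (K : Finset X) → (K → ℚ) → X → ℝ := fun K q x => if hx : x ∈ K then q ⟨x, hx⟩ else 0
  have H := fun (K : Finset X) (n : ℕ) (q : K → ℚ) (k : ℕ) =>
    exists_containsBox (hU n) (hd n) K (ext K q) (Nat.one_div_pos_of_nat (α := ℝ) (n := k))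
  choose W hKW c' hc' hbox using H
  obtain ⟨A, hA, hclosed⟩ := exists_countable_closed_under
    (fun K => ⋃ (n) (q) (k), (W K n q k : Set X)) fun K =>
      countable_iUnion fun n => countable_iUnion fun q => countable_iUnion fun k =>
        (W K n q k).countable_toSet
  refine ⟨A, hA, fun n K hK c ε hε => ?_⟩
  choose q hq hq' using fun x : X => exists_rat_btwn (sub_lt_self (c x) (half_pos hε))
  obtain ⟨k, hk⟩ := exists_nat_one_div_lt (half_pos hε)
  refine ⟨W K n (fun x => q x) k, hKW _ _ _ _, ?_, c' K n (fun x => q x) k, fun x hx => ?_,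
    hbox _ _ _ _⟩
  · refine Subset.trans ?_ (hclosed K hK)
    exact subset_iUnion_of_subset n (subset_iUnion_of_subset (fun x => q x)
      (subset_iUnion_of_subset k Subset.rfl))
  · have h1 := abs_lt.1 (hc' K n (fun x => q x) k x hx)
    have h2 : ext K (fun x => q x) x = q x := dif_pos hx
    rw [h2] at h1
    have h3 := hq x
    have h4 := hq' x
    exact abs_lt.2 ⟨by linarith [h1.1], by linarith [h1.2]⟩

open BoundedContinuousFunction in
/-- There is a (generic) sequence `u` of continuous functions such that any selection `s` among them
on a finite `K ⊆ A` extends to a larger finite subset of `A` on which the selected values force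
membership in `U n`. -/
theorem exists_generic_sequence {U : ℕ → Set {f : X → ℝ // BaireOne f}} {A : Set X}
    (hA : A.Countable)
    (hbox : ∀ n, ∀ K : Finset X, (K : Set X) ⊆ A → ∀ c : X → ℝ, ∀ ε > 0,
      ∃ K' : Finset X, K ⊆ K' ∧ (K' : Set X) ⊆ A ∧ ∃ c' : X → ℝ, (∀ x ∈ K, |c' x - c x| < ε) ∧
        ContainsBox (U n) K' c') :
    ∃ u : ℕ → X →ᵇ ℝ, ∀ n, ∀ K : Finset X, (K : Set X) ⊆ A → ∀ s : X → ℕ,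
      ∃ K' : Finset X, K ⊆ K' ∧ (K' : Set X) ⊆ A ∧ ∃ s' : X → ℕ, (∀ x ∈ K, s' x = s x) ∧
        ContainsBox (U n) K' fun x => u (s' x) x := by
  classical
  let G : ℕ → Finset X → (X → ℕ) → Set (ℕ → X →ᵇ ℝ) := fun n K s =>
    {u | ∃ K' : Finset X, K ⊆ K' ∧ (K' : Set X) ⊆ A ∧ ∃ s' : X → ℕ, (∀ x ∈ K, s' x = s x) ∧
        ContainsBox (U n) K' fun x => u (s' x) x}
  have hopen : ∀ n K s, IsOpen (G n K s) := by
    intro n K s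
    refine isOpen_iff_mem_nhds.2 ?_
    rintro u ⟨K', hKK', hK'A, s', hs', δ, hδ, hO⟩
    have hev : ∀ᶠ v in 𝓝 u, ∀ x ∈ K', |v (s' x) x - u (s' x) x| < δ / 2 := by
      refine (Filter.eventually_all_finset _).2 fun x _ => ?_
      have hcont : Continuous fun v : ℕ → X →ᵇ ℝ => v (s' x) x :=
        (continuous_eval_const x).comp (continuous_apply (s' x))
      exact (hcont.tendsto u).eventually (Metric.ball_mem_nhds _ (half_pos hδ))
    filter_upwards [hev] with v hv
    refine ⟨K', hKK', hK'A, s', hs', δ / 2, half_pos hδ, fun f hf => hO f fun x hx => ?_⟩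
    have h1 := abs_lt.1 (hv x hx)
    have h2 := abs_lt.1 (hf x hx)
    exact abs_lt.2 ⟨by linarith [h1.1, h2.1], by linarith [h1.2, h2.2]⟩
  have hdense : ∀ (n : ℕ) (K : Finset X) (s : X → ℕ), (K : Set X) ⊆ A → Dense (G n K s) := by
    intro n K s hK u
    have happrox : ∀ k : ℕ, ∃ v ∈ G n K s, ∀ j < k, dist (v j) (u j) ≤ 1 / (k + 1 : ℝ) := by
      intro k
      have hk : (0 : ℝ) < 1 / (k + 1 : ℝ) := by positivity
      obtain ⟨K', hKK', hK'A, c', hc', hO⟩ := hbox n K hK (fun x => u (s x) x) _ hk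
      obtain ⟨h, hnorm, hK_eq⟩ := exists_boundedContinuous_eq_on_finset K
        (fun x => c' x - u (s x) x) hk.le fun x hx => (hc' x hx).le
      obtain ⟨w, -, hw⟩ := exists_boundedContinuous_eq_on_finset K' c'
        (Finset.sum_nonneg fun x _ => abs_nonneg (c' x)) fun x hx =>
          Finset.single_le_sum (f := fun x => |c' x|) (fun x _ => abs_nonneg _) hx
      set J := max k (K.sup s + 1) with hJ
      refine ⟨fun j => if j = J then w else u j + h, ⟨K', hKK', hK'A,
        fun x => if x ∈ K then s x else J, fun x hx => if_pos hx,
        hO.mono Subset.rfl fun x hx => ?_⟩, fun j hj => ?_⟩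
      · by_cases hxK : x ∈ K
        · have hlt : s x < J := lt_max_of_lt_right (Nat.lt_succ_of_le (Finset.le_sup hxK))
          simp only [if_pos hxK, if_neg hlt.ne]
          rw [BoundedContinuousFunction.add_apply, hK_eq x hxK]
          ring
        · simp only [if_neg hxK, if_true]
          exact hw x hx
      · have hlt : j < J := lt_max_of_lt_left hj
        simp only [if_neg hlt.ne]
        rwa [dist_eq_norm, add_sub_cancel_left]
    choose v hvG hv using happrox
    refine mem_closure_of_tendsto (f := v) (b := atTop) (tendsto_pi_nhds.2 fun j => ?_)
      (Eventually.of_forall hvG)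
    rw [tendsto_iff_dist_tendsto_zero]
    refine squeeze_zero' (Eventually.of_forall fun _ => dist_nonneg) ?_
      tendsto_one_div_add_atTop_nhds_zero_nat
    filter_upwards [eventually_gt_atTop j] with k hk
    exact hv k j hk
  have : Countable {K : Finset X // (K : Set X) ⊆ A} :=
    (countable_finset_coe_subset hA).to_subtype
  let ext : (K : Finset X) → (K → ℕ) → X → ℕ := fun K q x => if hx : x ∈ K then q ⟨x, hx⟩ else 0
  have hinter := dense_iInter_of_isOpen
    (f := fun p : ℕ × (Σ K : {K : Finset X // (K : Set X) ⊆ A}, (K.1 → ℕ)) =>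
      G p.1 p.2.1.1 (ext p.2.1.1 p.2.2))
    (fun p => hopen _ _ _) fun p => hdense _ _ _ p.2.1.2
  obtain ⟨u, hu⟩ := hinter.nonempty
  refine ⟨u, fun n K hK s => ?_⟩
  obtain ⟨K', hKK', hK'A, s', hs', hO⟩ := mem_iInter.1 hu ⟨n, ⟨K, hK⟩, fun x => s x⟩
  exact ⟨K', hKK', hK'A, s', fun x hx => (hs' x hx).trans (dif_pos hx), hO⟩

end Generic

section Sequence

variable {X : Type*} [TopologicalSpace X]

/-- A single extension `t` beyond `K` that works for finitely many selections on `K`. -/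
theorem exists_common_extension {U : ℕ → Set {f : X → ℝ // BaireOne f}} {A : Set X}
    {u : ℕ → X → ℝ}
    (hu : ∀ n, ∀ K : Finset X, (K : Set X) ⊆ A → ∀ s : X → ℕ,
      ∃ K' : Finset X, K ⊆ K' ∧ (K' : Set X) ⊆ A ∧ ∃ s' : X → ℕ, (∀ x ∈ K, s' x = s x) ∧
        ContainsBox (U n) K' fun x => u (s' x) x)
    {K : Finset X} [DecidablePred (· ∈ K)] (hK : (K : Set X) ⊆ A) (L : List (ℕ × (X → ℕ))) :
    ∃ K' : Finset X, K ⊆ K' ∧ (K' : Set X) ⊆ A ∧ ∃ t : X → ℕ, ∀ p ∈ L,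
      ContainsBox (U p.1) K' fun x => u (if x ∈ K then p.2 x else t x) x := by
  classical
  induction L with
  | nil => exact ⟨K, Finset.Subset.refl _, hK, fun _ => 0, by simp⟩
  | cons q L ih =>
    obtain ⟨K₁, hKK₁, hK₁A, t₁, ht₁⟩ := ih
    obtain ⟨K₂, hKK₂, hK₂A, s, hs, hbox⟩ := hu q.1 K₁ hK₁A fun x => if x ∈ K then q.2 x else t₁ x
    refine ⟨K₂, hKK₁.trans hKK₂, hK₂A, fun x => if x ∈ K₁ then t₁ x else s x, ?_⟩
    rw [List.forall_mem_cons]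
    refine ⟨hbox.mono (Finset.Subset.refl _) fun x _ => ?_, fun p hp =>
      (ht₁ p hp).mono hKK₂ fun x hx => by simp only [if_pos hx]⟩
    congr 1
    by_cases h₁ : x ∈ K₁
    · rw [hs x h₁]
      simp only [if_pos h₁]
    · have hxK : x ∉ K := fun h => h₁ (hKK₁ h)
      simp only [if_neg h₁, if_neg hxK]

theorem exists_bounded_extension {U : ℕ → Set {f : X → ℝ // BaireOne f}} {A : Set X}
    (hA : A.Infinite) {u : ℕ → X → ℝ}
    (hu : ∀ n, ∀ K : Finset X, (K : Set X) ⊆ A → ∀ s : X → ℕ,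
      ∃ K' : Finset X, K ⊆ K' ∧ (K' : Set X) ⊆ A ∧ ∃ s' : X → ℕ, (∀ x ∈ K, s' x = s x) ∧
        ContainsBox (U n) K' fun x => u (s' x) x)
    {K : Finset X} [DecidablePred (· ∈ K)] (hK : (K : Set X) ⊆ A) (n T : ℕ) :
    ∃ K' : Finset X, K ⊂ K' ∧ (K' : Set X) ⊆ A ∧ ∃ t : X → ℕ, ∀ s : X → ℕ, (∀ x ∈ K, s x ≤ T) →
      ∀ i ≤ n, ContainsBox (U i) K' fun x => u (if x ∈ K then s x else t x) x := by
  classical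
  let e : Fin (n + 1) × (K → Fin (T + 1)) → ℕ × (X → ℕ) := fun p =>
    (p.1, fun x => if hx : x ∈ K then p.2 ⟨x, hx⟩ else 0)
  obtain ⟨K', hKK', hK'A, t, ht⟩ := exists_common_extension hu hK (Finset.univ.toList.map e)
  obtain ⟨a, haA, haK⟩ := hA.exists_notMem_finset K
  refine ⟨insert a K', ?_, ?_, t, fun s hs i hi => ?_⟩
  · exact ⟨hKK'.trans (Finset.subset_insert _ _), fun h => haK (h (Finset.mem_insert_self _ _))⟩
  · rw [Finset.coe_insert]
    exact insert_subset haA hK'A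
  · refine (ht (e (⟨i, Nat.lt_succ_of_le hi⟩, fun x => ⟨s x, Nat.lt_succ_of_le (hs x x.2)⟩))
      (List.mem_map_of_mem (Finset.mem_toList.2 (Finset.mem_univ _)))).mono
      (Finset.subset_insert _ _) fun x _ => ?_
    by_cases hx : x ∈ K
    · simp [e, hx]
    · simp [hx]

open Classical in
/-- Finite sets `K n` and a selector `t` such that, whatever bounded selection is made on `K n`,
following `t` on `K (n + 1) \ K n` forces membership in `U 0, …, U n`. -/
theorem exists_increasing_finsets {U : ℕ → Set {f : X → ℝ // BaireOne f}} {A : Set X}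
    (hA : A.Infinite) {u : ℕ → X → ℝ}
    (hu : ∀ n, ∀ K : Finset X, (K : Set X) ⊆ A → ∀ s : X → ℕ,
      ∃ K' : Finset X, K ⊆ K' ∧ (K' : Set X) ⊆ A ∧ ∃ s' : X → ℕ, (∀ x ∈ K, s' x = s x) ∧
        ContainsBox (U n) K' fun x => u (s' x) x) :
    ∃ (K : ℕ → Finset X) (t : X → ℕ), (∀ n, K n ⊂ K (n + 1)) ∧
      ∀ n, ∀ s : X → ℕ, (∀ x ∈ K n, s x ≤ (K n).sup t) → ∀ i ≤ n,
        ContainsBox (U i) (K (n + 1)) fun x => u (if x ∈ K n then s x else t x) x := by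
  have hstep : ∀ (n : ℕ) (p : {K : Finset X // (K : Set X) ⊆ A} × (X → ℕ)),
      ∃ p' : {K : Finset X // (K : Set X) ⊆ A} × (X → ℕ), p.1.1 ⊂ p'.1.1 ∧
        (∀ x ∈ p.1.1, p'.2 x = p.2 x) ∧ ∀ s : X → ℕ, (∀ x ∈ p.1.1, s x ≤ p.1.1.sup p.2) →
          ∀ i ≤ n, ContainsBox (U i) p'.1.1 fun x => u (if x ∈ p.1.1 then s x else p'.2 x) x := by
    rintro n ⟨⟨K, hK⟩, t⟩
    obtain ⟨K', hKK', hK'A, t', ht'⟩ := exists_bounded_extension hA hu hK n (K.sup t)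
    refine ⟨⟨⟨K', hK'A⟩, fun x => if x ∈ K then t x else t' x⟩, hKK', fun x hx => if_pos hx,
      fun s hs i hi => (ht' s hs i hi).mono (Finset.Subset.refl _) fun x _ => ?_⟩
    by_cases hx : x ∈ K <;> simp [hx]
  choose step hss hstab hbox using hstep
  let seq : ℕ → {K : Finset X // (K : Set X) ⊆ A} × (X → ℕ) := fun n =>
    Nat.rec (⟨∅, by simp⟩, fun _ => 0) step n
  have hmono : Monotone fun n => (seq n).1.1 := monotone_nat_of_le_succ fun n => (hss n (seq n)).1
  have hstab' : ∀ m n, m ≤ n → ∀ x ∈ (seq m).1.1, (seq n).2 x = (seq m).2 x := by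
    intro m n hmn x hx
    induction n, hmn using Nat.le_induction with
    | base => rfl
    | succ n hmn ih => exact (hstab n (seq n) x (hmono hmn hx)).trans ih
  let t : X → ℕ := fun x => if h : ∃ n, x ∈ (seq n).1.1 then (seq (Nat.find h)).2 x else 0
  have ht : ∀ n, ∀ x ∈ (seq n).1.1, t x = (seq n).2 x := by
    intro n x hx
    have h : ∃ n, x ∈ (seq n).1.1 := ⟨n, hx⟩
    simp only [t, dif_pos h]
    exact (hstab' _ _ (Nat.find_min' h hx) x (Nat.find_spec h)).symm
  refine ⟨fun n => (seq n).1.1, t, fun n => hss n (seq n),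
    fun n s hs i hi => ?_⟩
  refine (hbox n (seq n) s (fun x hx => ?_) i hi).mono (Finset.Subset.refl _) fun x hx => ?_
  · rw [← Finset.sup_congr rfl (ht n)]
    exact hs x hx
  · have := ht (n + 1) x hx
    show u (if x ∈ (seq n).1.1 then s x else t x) x = _
    rw [this]

end Sequence

theorem not_isMeagre_of_stronglyCozDeltaDisjoint {X : Type*} [TopologicalSpace X] [T35Space X]
    (h : ∀ Δ : ℕ → Set X, (∀ n, (Δ n).Finite ∧ (Δ n).Nonempty) →
      (Pairwise fun n m => Disjoint (Δ n) (Δ m)) →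
      ∃ φ : ℕ → ℕ, StrictMono φ ∧ StronglyCozDeltaDisjoint (⋃ k, Δ (φ k))) :
    ¬ IsMeagre (Set.univ : Set {f : X → ℝ // BaireOne f}) := by
  classical
  intro hmeagre
  rw [IsMeagre, compl_univ, mem_residual_iff] at hmeagre
  obtain ⟨S, hSo, hSd, hSc, hS⟩ := hmeagre
  obtain ⟨U, hUS⟩ := (hSc.insert univ).exists_eq_range (insert_nonempty _ _)
  have hUmem : ∀ n, U n = univ ∨ U n ∈ S := fun n => by
    have : U n ∈ insert univ S := hUS ▸ mem_range_self n
    exact this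
  have hUo : ∀ n, IsOpen (U n) := fun n => (hUmem n).elim (fun h => h ▸ isOpen_univ) (hSo _)
  have hUd : ∀ n, Dense (U n) := fun n => (hUmem n).elim (fun h => h ▸ dense_univ) (hSd _)
  have hempty : ∀ f, ¬ ∀ n, f ∈ U n := by
    intro f hf
    refine hS (a := f) (mem_sInter.2 fun V hV => ?_)
    obtain ⟨n, rfl⟩ : V ∈ range U := hUS ▸ mem_insert_of_mem _ hV
    exact hf n
  obtain ⟨A, hAc, hA⟩ := exists_countable_containsBox hUo hUd
  obtain ⟨u, hu⟩ := exists_generic_sequence hAc hA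
  rcases A.finite_or_infinite with hAfin | hAinf
  · refine hempty ⟨u 0, baireOne_of_continuous (u 0).continuous⟩ fun n => ?_
    obtain ⟨K', -, hK'A, s, hs, δ, hδ, hO⟩ := hu n hAfin.toFinset (by simp) fun _ => 0
    refine hO _ fun x hx => ?_
    show |u 0 x - u (s x) x| < δ
    rw [hs x (hAfin.mem_toFinset.2 (hK'A hx)), sub_self, abs_zero]
    exact hδ
  obtain ⟨K, t, hKss, hbox⟩ := exists_increasing_finsets (u := fun n => u n) hAinf hu
  have hKmono : Monotone K := monotone_nat_of_le_succ fun n => (hKss n).1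
  let Δ : ℕ → Set X := fun n => (K (n + 1) : Set X) \ K n
  have hΔ : ∀ n, (Δ n).Finite ∧ (Δ n).Nonempty := fun n =>
    ⟨(K (n + 1)).finite_toSet.subset sdiff_subset, Set.sdiff_nonempty.2 fun hsub => (hKss n).2 hsub⟩
  have hΔlt : ∀ m n, m < n → Disjoint (Δ m) (Δ n) := fun m n hmn =>
    Set.disjoint_left.2 fun x hxm hxn => hxn.2 (hKmono hmn hxm.1)
  have hdisj : Pairwise fun n m => Disjoint (Δ n) (Δ m) := fun m n hne =>
    (lt_or_gt_of_ne hne).elim (hΔlt m n) fun hlt => (hΔlt n m hlt).symm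
  obtain ⟨φ, hφ, hA'⟩ := h Δ hΔ hdisj
  have hψ : ∀ b : X, ∃ ψ : X → ℝ, Continuous ψ ∧ ∀ k, b ∈ Δ k → ψ b ≠ 0 ∧ ∀ x ∈ K k, ψ x = 0 := by
    intro b
    by_cases hb : ∃ k, b ∈ Δ k
    · obtain ⟨k, hk⟩ := hb
      obtain ⟨ψ, hψc, hψ⟩ := exists_continuous_eq_on_finset (insert b (K k))
        fun x => if x = b then 1 else 0
      refine ⟨ψ, hψc, fun k' hk' => ?_⟩
      obtain rfl : k' = k := by
        by_contra hne
        exact Set.disjoint_left.1 (hdisj hne) hk' hk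
      refine ⟨by simp [hψ b (Finset.mem_insert_self _ _)], fun x hx => ?_⟩
      rw [hψ x (Finset.mem_insert_of_mem hx), if_neg]
      rintro rfl
      exact hk.2 hx
    · exact ⟨fun _ => 0, continuous_const, fun k hk => absurd ⟨k, hk⟩ hb⟩
  choose ψ hψc hψ using hψ
  obtain ⟨g, hg, hgt, hg0⟩ := hA'.exists_selector
    (countable_iUnion fun k => (hΔ (φ k)).1.countable)
    ((hΔ (φ 0)).2.mono (subset_iUnion (fun k => Δ (φ k)) 0)) t (ψ := ψ) (fun b _ => hψc b)
    (fun b hb => by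
      obtain ⟨k, hk⟩ := mem_iUnion.1 hb
      exact (hψ b _ hk).1)
    (u := fun n => u n) fun n => (u n).continuous
  refine hempty ⟨fun x => u (g x) x, hg⟩ fun i => ?_
  have hbound : ∀ n, ∀ x ∈ K n, g x ≤ (K n).sup t := by
    intro n x hx
    rcases hg0 x with h0 | ⟨b, hb, hgb, hψb⟩
    · rw [h0]
      exact Nat.zero_le _
    · obtain ⟨k, hk⟩ := mem_iUnion.1 hb
      have hkn : φ k < n := by
        by_contra hle
        exact hψb ((hψ b _ hk).2 x (hKmono (not_lt.1 hle) hx))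
      rw [hgb]
      exact Finset.le_sup (hKmono hkn hk.1)
  obtain ⟨δ, hδ, hO⟩ := hbox (φ i) g (hbound _) i hφ.le_apply
  refine hO _ fun x hx => ?_
  have hsel : (if x ∈ K (φ i) then g x else t x) = g x := by
    split_ifs with hxK
    · rfl
    · exact (hgt x (mem_iUnion.2 ⟨i, hx, hxK⟩)).symm
  show |u (g x) x - u (if x ∈ K (φ i) then g x else t x) x| < δ
  rw [hsel, sub_self, abs_zero]
  exact hδ

/-- For a Tychonoff space `X`, the space `B₁(X)` is meager in itself iff
there is a pairwise disjoint sequence of nonempty finite subsets of `X` containing no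
strongly Coz_δ-disjoint subsequence. -/
theorem statement1 {X : Type*} [TopologicalSpace X] [T35Space X] :
    IsMeagre (Set.univ : Set {f : X → ℝ // BaireOne f}) ↔
      ∃ Δ : ℕ → Set X,
        (∀ n, (Δ n).Finite ∧ (Δ n).Nonempty) ∧
        (Pairwise fun n m => Disjoint (Δ n) (Δ m)) ∧
        ∀ φ : ℕ → ℕ, StrictMono φ →
          ¬ StronglyCozDeltaDisjoint (⋃ k, Δ (φ k)) := by
  constructor
  · intro hmeagre
    by_contra h
    push Not at h
    exact not_isMeagre_of_stronglyCozDeltaDisjoint h hmeagre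
  · rintro ⟨Δ, hΔ, hdisj, h⟩
    exact isMeagre_of_no_stronglyCozDeltaDisjoint (fun n => (hΔ n).1) hdisj h
end

section
/- Let {X_α : α ∈ A} be a family of Tychonoff (completely regular Hausdorff) topological spaces such that B_1(X_α) is a Baire space for every α ∈ A. Then the product space ∏_{α∈A} B_1(X_α) is a Baire space. -/
open Set Topology Filter

/-- The category analogue of Fubini's theorem for one factor of a product: for a dense set of
values `z` of the coordinate `i`, the sections at `z` of countably many dense open sets are dense. -/
theorem dense_setOf_forall_dense_section {ι : Type*} [DecidableEq ι] {Z : ι → Type*}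
    [∀ i, TopologicalSpace (Z i)] [SecondCountableTopology (∀ i, Z i)]
    (i : ι) [BaireSpace (Z i)] {U : ℕ → Set (∀ i, Z i)} (hUo : ∀ k, IsOpen (U k))
    (hUd : ∀ k, Dense (U k)) :
    Dense {z : Z i | ∀ k, Dense {y | Function.update y i z ∈ U k}} := by
  set b := TopologicalSpace.countableBasis (∀ i, Z i)
  have hb : TopologicalSpace.IsTopologicalBasis b :=
    TopologicalSpace.isBasis_countableBasis _
  have : Countable b := (TopologicalSpace.countable_countableBasis _).to_subtype
  have key : Dense (⋂ j : b × ℕ, {z : Z i | ∃ y ∈ j.1.1, Function.update y i z ∈ U j.2}) := by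
    refine dense_iInter_of_isOpen (fun j => ?_) (fun j => ?_)
    · have : {z : Z i | ∃ y ∈ j.1.1, Function.update y i z ∈ U j.2} =
          ⋃ y ∈ j.1.1, (fun z => Function.update y i z) ⁻¹' U j.2 := by
        ext; simp
      rw [this]
      exact isOpen_biUnion fun y _ => (hUo j.2).preimage (by fun_prop)
    · rw [dense_iff_inter_open]
      rintro O hO ⟨z₀, hz₀⟩
      obtain ⟨y₀, hy₀⟩ := TopologicalSpace.nonempty_of_mem_countableBasis j.1.2
      have hV : IsOpen ((fun p : ∀ i, Z i => p i) ⁻¹' O ∩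
          (fun p => Function.update p i (y₀ i)) ⁻¹' j.1.1) :=
        (hO.preimage (by fun_prop)).inter
          ((TopologicalSpace.isOpen_of_mem_countableBasis j.1.2).preimage (by fun_prop))
      obtain ⟨p, ⟨hpO, hpb⟩, hpU⟩ := (hUd j.2).inter_open_nonempty _ hV
        ⟨Function.update y₀ i z₀, by simpa using hz₀, by simpa using hy₀⟩
      exact ⟨p i, hpO, _, hpb, by simpa using hpU⟩
  refine key.mono fun z hz k => ?_
  rw [dense_iff_inter_open]
  rintro O hO ⟨y, hy⟩
  obtain ⟨B, hB, hyB, hBO⟩ := hb.exists_subset_of_mem_open hy hO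
  obtain ⟨y', hy', hU⟩ := mem_iInter.1 hz (⟨B, hB⟩, k)
  exact ⟨y', hBO hy', hU⟩

open Classical in
/-- **Oxtoby's theorem**: a countable product of second countable Baire spaces is Baire. -/
theorem BaireSpace.pi_of_secondCountable {ι : Type*} [Countable ι] {Z : ι → Type*}
    [∀ i, TopologicalSpace (Z i)] [∀ i, SecondCountableTopology (Z i)] [∀ i, BaireSpace (Z i)] :
    BaireSpace (∀ i, Z i) := by
  refine ⟨fun U hUo hUd => ?_⟩
  rw [dense_iff_inter_open]
  rintro W₀ hW₀ ⟨p₀, hp₀⟩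
  rcases isEmpty_or_nonempty ι with hι | hι
  · refine ⟨p₀, hp₀, mem_iInter.2 fun k => ?_⟩
    obtain ⟨x, hx⟩ := (hUd k).inter_open_nonempty _ isOpen_univ ⟨p₀, mem_univ _⟩
    rw [Subsingleton.elim p₀ x]
    exact hx.2
  obtain ⟨e, he⟩ := exists_surjective_nat ι
  let E : ℕ → Set ι := fun n => e '' Iio n
  have hEs (n) : E (n + 1) = insert (e n) (E n) := by
    simp only [E, ← image_insert_eq]
    congr 1
    ext m
    simp
  let Inv : ℕ → (∀ i, Z i) × Set (∀ i, Z i) → Prop := fun n s =>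
    IsOpen s.2 ∧ (∃ y, (E n).piecewise s.1 y ∈ s.2) ∧
      ∀ k, Dense {y | (E n).piecewise s.1 y ∈ U k}
  have hcont (n) (p : ∀ i, Z i) : Continuous fun y => (E n).piecewise p y := by
    refine continuous_pi fun i => ?_
    by_cases hi : i ∈ E n <;> simp [hi] <;> fun_prop
  have step : ∀ n s, Inv n s → ∃ s' : (∀ i, Z i) × Set (∀ i, Z i), Inv (n + 1) s' ∧
      (∀ i ∈ E n, s'.1 i = s.1 i) ∧ s'.2 ⊆ s.2 ∩ U n ∧
      ∃ F : Finset ι, ∀ x y : ∀ i, Z i, (∀ i ∈ F, x i = y i) → x ∈ s'.2 → y ∈ s'.2 := by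
    rintro n ⟨p, W⟩ ⟨hWo, hWn, hd⟩
    obtain ⟨y, hyW, hyU⟩ := (hd n).inter_open_nonempty _ (hWo.preimage (hcont n p)) hWn
    obtain ⟨F, u, hu, hsub⟩ := isOpen_pi_iff.1 (hWo.inter (hUo n)) _ ⟨hyW, hyU⟩
    have hBo : IsOpen ((F : Set ι).pi u) :=
      isOpen_set_pi F.finite_toSet fun i hi => (hu i hi).1
    have hyB : (E n).piecewise p y ∈ (F : Set ι).pi u := fun i hi => (hu i hi).2
    have hF : ∃ F' : Finset ι, ∀ x y : ∀ i, Z i, (∀ i ∈ F', x i = y i) →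
        x ∈ (F : Set ι).pi u → y ∈ (F : Set ι).pi u :=
      ⟨F, fun x y hxy hx i hi => hxy i hi ▸ hx i hi⟩
    by_cases hen : e n ∈ E n
    · have hE : E (n + 1) = E n := by rw [hEs, insert_eq_of_mem hen]
      refine ⟨(p, (F : Set ι).pi u), ⟨hBo, ⟨y, ?_⟩, ?_⟩, fun _ _ => rfl, hsub, hF⟩
      · rw [hE]; exact hyB
      · rw [hE]; exact hd
    · have hpw (z : Z (e n)) (y : ∀ i, Z i) :
          (E (n + 1)).piecewise (Function.update p (e n) z) y =
            (E n).piecewise p (Function.update y (e n) z) := by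
        ext i
        rw [hEs]
        by_cases h : i = e n
        · subst h
          simp [hen]
        · by_cases h' : i ∈ E n <;> simp [Set.piecewise, h, h']
      have hdense := dense_setOf_forall_dense_section (e n)
        (fun k => (hUo k).preimage (hcont n p)) hd
      obtain ⟨z, hz, hzd⟩ := hdense.inter_open_nonempty
        ((fun z => Function.update y (e n) z) ⁻¹' ((fun y => (E n).piecewise p y) ⁻¹'
          (F : Set ι).pi u)) ((hBo.preimage (hcont n p)).preimage (by fun_prop))
        ⟨y (e n), by simpa using hyB⟩
      refine ⟨(Function.update p (e n) z, (F : Set ι).pi u), ⟨hBo, ⟨y, ?_⟩, fun k => ?_⟩,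
        fun i hi => ?_, hsub, hF⟩
      · rw [hpw]; exact hz
      · simp only [hpw]; exact hzd k
      · exact Function.update_of_ne (ne_of_mem_of_not_mem hi hen) _ _
  choose! next hInv hagree hsub hsupp using step
  let s : ℕ → (∀ i, Z i) × Set (∀ i, Z i) := fun n => Nat.rec (p₀, W₀) (fun n s => next n s) n
  have hs (n) : Inv n (s n) := by
    induction n with
    | zero =>
      have h0 (y : ∀ i, Z i) : (E 0).piecewise p₀ y = y :=
        funext fun i => piecewise_eq_of_notMem _ _ _ (by simp [E])
      refine ⟨hW₀, ⟨p₀, (h0 p₀).symm ▸ hp₀⟩, fun k => ?_⟩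
      change Dense {y | (E 0).piecewise p₀ y ∈ U k}
      simp_rw [h0]
      exact hUd k
    | succ n ih => exact hInv n _ ih
  have hEmono : Monotone E := fun a b hab => image_mono (Iio_subset_Iio hab)
  have hWanti : Antitone fun n => (s n).2 :=
    antitone_nat_of_succ_le fun n => (hsub n _ (hs n)).trans inter_subset_left
  have hstable (m n) (hmn : m ≤ n) : ∀ i ∈ E m, (s n).1 i = (s m).1 i := by
    induction n, hmn using Nat.le_induction with
    | base => exact fun _ _ => rfl
    | succ n hmn ih =>
      exact fun i hi => (hagree n _ (hs n) i (hEmono hmn hi)).trans (ih i hi)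
  choose idx hidx using he
  let q : ∀ i, Z i := fun i => (s (idx i + 1)).1 i
  have hq (m i) (hi : i ∈ E m) : q i = (s m).1 i := by
    have hi' : i ∈ E (idx i + 1) := ⟨idx i, by simp, hidx i⟩
    rcases le_total m (idx i + 1) with h | h
    · exact hstable _ _ h i hi
    · exact (hstable _ _ h i hi').symm
  have hqW (n) : q ∈ (s (n + 1)).2 := by
    obtain ⟨F, hF⟩ := hsupp n _ (hs n)
    obtain ⟨M, hM⟩ : ∃ M, ∀ i ∈ F, idx i < M :=
      ⟨F.sup idx + 1, fun i hi => Nat.lt_succ_of_le (Finset.le_sup (f := idx) hi)⟩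
    obtain ⟨y, hy⟩ := (hs (max M (n + 1))).2.1
    refine hF _ _ (fun i hi => ?_) (hWanti (le_max_right M (n + 1)) hy)
    have hiE : i ∈ E (max M (n + 1)) := ⟨idx i, (hM i hi).trans_le (le_max_left _ _), hidx i⟩
    rw [Set.piecewise_eq_of_mem _ _ _ hiE, hq _ i hiE]
  exact ⟨q, (hsub 0 _ (hs 0) (hqW 0)).1, mem_iInter.2 fun n => (hsub n _ (hs n) (hqW n)).2⟩

/-- In a space with the topology induced from a power of `ℝ`, every point of an open set has a
neighbourhood inside it given by finitely many coordinates and basic open sets of `ℝ`. -/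
theorem Topology.IsInducing.exists_finset_countableBasis {Q J : Type*} [TopologicalSpace Q]
    {r : Q → J → ℝ} (hr : IsInducing r) {U : Set Q} (hU : IsOpen U) {q : Q} (hq : q ∈ U) :
    ∃ c : Finset (J × TopologicalSpace.countableBasis ℝ), (∀ j ∈ c, r q j.1 ∈ j.2.1) ∧
      ∀ q', (∀ j ∈ c, r q' j.1 ∈ j.2.1) → q' ∈ U := by
  classical
  obtain ⟨V, hV, rfl⟩ := hr.isOpen_iff.1 hU
  obtain ⟨F, u, hu, hsub⟩ := isOpen_pi_iff.1 hV _ hq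
  have hB (i : J) : ∃ B : TopologicalSpace.countableBasis ℝ,
      r q i ∈ B.1 ∧ (i ∈ F → B.1 ⊆ u i) := by
    by_cases hi : i ∈ F
    · obtain ⟨B, hB, hqB, hBu⟩ :=
        (TopologicalSpace.isBasis_countableBasis ℝ).exists_subset_of_mem_open (hu i hi).2 (hu i hi).1
      exact ⟨⟨B, hB⟩, hqB, fun _ => hBu⟩
    · obtain ⟨B, hB, hqB, -⟩ :=
        (TopologicalSpace.isBasis_countableBasis ℝ).exists_subset_of_mem_open
          (mem_univ (r q i)) isOpen_univ
      exact ⟨⟨B, hB⟩, hqB, fun h => absurd h hi⟩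
  choose B hqB hBu using hB
  refine ⟨F.image fun i => (i, B i), by simpa using fun i _ => hqB i, fun q' hq' => ?_⟩
  refine hsub fun i hi => hBu i hi ?_
  simpa using hq' (i, B i) (Finset.mem_image_of_mem _ hi)

/-- For countably many operations on finite subsets of `I × κ`, with `κ` countable, every finite
set is supported in a countable `S ⊆ I` such that the operations preserve being supported in `S`. -/
theorem exists_countable_closed_under_finset_ops {I κ : Type*} [Countable κ]
    (F : Finset (I × κ) → ℕ → Finset (I × κ)) (c₀ : Finset (I × κ)) :
    ∃ S : Set I, S.Countable ∧ (∀ j ∈ c₀, j.1 ∈ S) ∧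
      ∀ c : Finset (I × κ), (∀ j ∈ c, j.1 ∈ S) → ∀ k, ∀ j ∈ F c k, j.1 ∈ S := by
  let codes : Set I → Set (Finset (I × κ)) := fun S => {c | ∀ j ∈ c, j.1 ∈ S}
  let enlarge : Set I → Set I := fun S => S ∪ ⋃ c ∈ codes S, ⋃ k, Prod.fst '' (F c k : Set (I × κ))
  let S : ℕ → Set I := fun n => Nat.rec (Prod.fst '' (c₀ : Set (I × κ))) (fun _ T => enlarge T) n
  have hover {T : Set I} (hT : T.Countable) : (codes T).Countable := by
    have h := (countable_ofPred_finite_subset (hT.prod (countable_univ (α := κ)))).preimage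
      (Finset.coe_injective (α := I × κ))
    refine h.mono fun c hc => ?_
    exact ⟨c.finite_toSet, fun j hj => ⟨hc j hj, mem_univ _⟩⟩
  have hS (n) : (S n).Countable := by
    induction n with
    | zero => exact (c₀.finite_toSet.image _).countable
    | succ n ih =>
      exact ih.union ((hover ih).biUnion fun c _ => countable_iUnion fun k =>
        ((F c k).finite_toSet.image _).countable)
  have hmono : Monotone S := monotone_nat_of_le_succ fun n => subset_union_left
  refine ⟨⋃ n, S n, countable_iUnion hS,
    fun j hj => mem_iUnion.2 ⟨0, mem_image_of_mem _ hj⟩, fun c hc k j hj => ?_⟩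
  obtain ⟨n, hn⟩ : ∃ n, c ∈ codes (S n) := by
    have hex (j : I × κ) (hj : j ∈ c) : ∃ n, j.1 ∈ S n := mem_iUnion.1 (hc j hj)
    choose! n hn using hex
    exact ⟨c.sup n, fun j hj => hmono (Finset.le_sup hj) (hn j hj)⟩
  exact mem_iUnion.2 ⟨n + 1, Or.inr (mem_iUnion₂.2
    ⟨c, hn, mem_iUnion.2 ⟨k, mem_image_of_mem _ hj⟩⟩)⟩

/-- A space with the topology induced from a power of `ℝ` is Baire as soon as all its projections
to countably many coordinates are. -/
theorem BaireSpace.of_countable_projections {Q I : Type*} [TopologicalSpace Q]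
    {r : Q → I → ℝ} (hr : IsInducing r)
    (h : ∀ S : Set I, S.Countable → BaireSpace (range fun (q : Q) (s : S) => r q s)) :
    BaireSpace Q := by
  classical
  refine ⟨fun U hUo hUd => ?_⟩
  rw [dense_iff_inter_open]
  rintro W hW ⟨q₀, hq₀⟩
  let κ := TopologicalSpace.countableBasis ℝ
  have : Countable κ := (TopologicalSpace.countable_countableBasis ℝ).to_subtype
  let box : Finset (I × κ) → Set Q := fun c => {q | ∀ j ∈ c, r q j.1 ∈ j.2.1}
  have hbox (c) : IsOpen (box c) := by
    have : box c = ⋂ j ∈ c, (fun q => r q j.1) ⁻¹' j.2.1 := by ext; simp [box]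
    rw [this]
    exact isOpen_biInter_finset fun j _ =>
      (TopologicalSpace.isOpen_of_mem_countableBasis j.2.2).preimage
        ((continuous_apply j.1).comp hr.continuous)
  have hshrink (c : Finset (I × κ)) (k : ℕ) :
      ∃ c', (box c).Nonempty → (box c').Nonempty ∧ box c' ⊆ box c ∩ U k := by
    by_cases hc : (box c).Nonempty
    · obtain ⟨q, hq⟩ := (hUd k).inter_open_nonempty _ (hbox c) hc
      obtain ⟨c', hqc', hc'⟩ := hr.exists_finset_countableBasis ((hbox c).inter (hUo k)) hq
      exact ⟨c', fun _ => ⟨⟨q, hqc'⟩, hc'⟩⟩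
    · exact ⟨c, fun h => absurd h hc⟩
  choose F hF using hshrink
  obtain ⟨c₀, hqc₀, hc₀⟩ := hr.exists_finset_countableBasis hW hq₀
  obtain ⟨S, hSc, hc₀S, hFS⟩ := exists_countable_closed_under_finset_ops F c₀
  have := h S hSc
  let π : Q → range fun (q : Q) (s : S) => r q s := rangeFactorization _
  have hπ : Function.Surjective π := rangeFactorization_surjective
  let box' : Finset (I × κ) → Set (range fun (q : Q) (s : S) => r q s) :=
    fun c => {z | ∀ j ∈ c, ∀ hj : j.1 ∈ S, z.1 ⟨j.1, hj⟩ ∈ j.2.1}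
  have hbox' (c) : IsOpen (box' c) := by
    have : box' c = ⋂ j ∈ c, ⋂ hj : j.1 ∈ S,
        (fun z : range fun (q : Q) (s : S) => r q s => z.1 ⟨j.1, hj⟩) ⁻¹' j.2.1 := by
      ext; simp [box']
    rw [this]
    refine isOpen_biInter_finset fun j _ => isOpen_iInter_of_finite fun hj =>
      (TopologicalSpace.isOpen_of_mem_countableBasis j.2.2).preimage
        ((continuous_apply _).comp continuous_subtype_val)
  have hmem (c) (hc : ∀ j ∈ c, j.1 ∈ S) (q : Q) : π q ∈ box' c ↔ q ∈ box c :=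
    ⟨fun h j hj => h j hj (hc j hj), fun h j hj _ => h j hj⟩
  let D : ℕ → Set (range fun (q : Q) (s : S) => r q s) := fun k =>
    ⋃ c ∈ {c | (∀ j ∈ c, j.1 ∈ S) ∧ box c ⊆ U k}, box' c
  have hDo (k) : IsOpen (D k) := isOpen_biUnion fun c _ => hbox' c
  have hDd (k) : Dense (D k) := by
    rw [dense_iff_inter_open]
    rintro O hO ⟨z, hz⟩
    obtain ⟨q, rfl⟩ := hπ z
    obtain ⟨c, hqc, hc⟩ := IsInducing.subtypeVal.exists_finset_countableBasis hO hz
    let c' : Finset (I × κ) := c.image fun j => (j.1.1, j.2)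
    have hc'S : ∀ j ∈ c', j.1 ∈ S := by
      intro j hj
      obtain ⟨i, -, rfl⟩ := Finset.mem_image.1 hj
      exact i.1.2
    have hmem' (q : Q) : q ∈ box c' ↔ ∀ j ∈ c, (π q).1 j.1 ∈ j.2.1 :=
      Finset.forall_mem_image
    obtain ⟨⟨q', hq'⟩, hsub⟩ := hF c' k ⟨q, (hmem' q).2 hqc⟩
    refine ⟨π q', hc _ ((hmem' q').1 (hsub hq').1), mem_iUnion₂.2
      ⟨F c' k, ⟨hFS c' hc'S k, hsub.trans inter_subset_right⟩, (hmem _ (hFS c' hc'S k) _).2 hq'⟩⟩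
  obtain ⟨z, hz₀, hz⟩ := (dense_iInter_of_isOpen hDo hDd).inter_open_nonempty _ (hbox' c₀)
    ⟨π q₀, (hmem c₀ hc₀S q₀).2 hqc₀⟩
  obtain ⟨q, rfl⟩ := hπ z
  refine ⟨q, hc₀ q ((hmem c₀ hc₀S q).1 hz₀), mem_iInter.2 fun k => ?_⟩
  obtain ⟨c, ⟨hcS, hcU⟩, hc⟩ := mem_iUnion₂.1 (mem_iInter.1 hz k)
  exact hcU ((hmem c hcS q).1 hc)

/-- Every projection of a dense Baire subspace of a power of `ℝ` to a set of coordinates is Baire. -/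
theorem BaireSpace.range_projection_of_dense {I : Type*} {Y : Set (I → ℝ)} (hY : Dense Y)
    [BaireSpace Y] (S : Set I) :
    BaireSpace (range fun (f : Y) (s : S) => f.1 s) := by
  classical
  refine ⟨fun D hDo hDd => ?_⟩
  let ρ : (I → ℝ) → S → ℝ := fun x s => x s
  have hρo : IsOpenMap ρ :=
    isOpenMap_fst.comp (Homeomorph.piEquivPiSubtypeProd (· ∈ S) fun _ => ℝ).isOpenMap
  have hρc : Continuous ρ := by fun_prop
  have hρs : Function.Surjective ρ := fun z => ⟨fun i => if hi : i ∈ S then z ⟨i, hi⟩ else 0, by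
    ext s; simp [ρ]⟩
  let π : Y → range fun (f : Y) (s : S) => f.1 s := rangeFactorization _
  have hπc : Continuous π := by
    refine Continuous.subtype_mk (continuous_pi fun s => ?_) _
    exact (continuous_apply s.1).comp continuous_subtype_val
  have hπs : Function.Surjective π := rangeFactorization_surjective
  have hZ : DenseRange (Subtype.val : (range fun (f : Y) (s : S) => f.1 s) → S → ℝ) := by
    rw [DenseRange, Subtype.range_coe]
    have := hρs.denseRange.dense_image hρc hY
    rwa [image_eq_range] at this
  have hpre (k) : Dense (π ⁻¹' D k) := by
    obtain ⟨O, hO, hOD⟩ := isOpen_induced_iff.1 (hDo k)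
    have hOd : Dense O := by
      refine (hZ.dense_image continuous_subtype_val (hDd k)).mono ?_
      rw [← hOD]
      exact image_preimage_subset _ _
    have hOY := (hOd.preimage hρo).inter_of_isOpen_left hY (hO.preimage hρc)
    rw [dense_iff_inter_open]
    rintro V hV ⟨y, hy⟩
    obtain ⟨V', hV', rfl⟩ := isOpen_induced_iff.1 hV
    obtain ⟨x, hxV, hxO, hxY⟩ := hOY.inter_open_nonempty V' hV' ⟨y, hy⟩
    refine ⟨⟨x, hxY⟩, hxV, ?_⟩
    rw [← hOD]
    exact hxO
  have := (hπs.denseRange.dense_image hπc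
    (dense_iInter_of_isOpen (fun k => (hDo k).preimage hπc) hpre))
  refine this.mono ?_
  rw [← preimage_iInter]
  exact image_preimage_subset _ _

/-- A product of dense Baire subspaces of powers of `ℝ` is Baire. -/
theorem BaireSpace.pi_of_dense {A : Type*} {X : A → Type*} {Y : ∀ α, Set (X α → ℝ)}
    (hY : ∀ α, Dense (Y α)) (h : ∀ α, BaireSpace (Y α)) : BaireSpace (∀ α, Y α) := by
  classical
  let r : (∀ α, Y α) → (Σ α, X α) → ℝ := fun q s => (q s.1).1 s.2
  have hr : IsInducing r := by
    refine ⟨?_⟩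
    simp only [Pi.topologicalSpace, instTopologicalSpaceSubtype, induced_iInf, induced_compose,
      iInf_sigma]
    rfl
  refine BaireSpace.of_countable_projections hr fun S hS => ?_
  let A₀ := Sigma.fst '' S
  have : Countable A₀ := (hS.image _).to_subtype
  let T : ∀ α, Set (X α) := fun α => Sigma.mk α ⁻¹' S
  have hT (α) : Countable (T α) := (hS.preimage sigma_mk_injective).to_subtype
  let Z : A₀ → Type _ := fun α => range fun (f : Y α) (x : T α) => f.1 x
  have hZ (α : A₀) : BaireSpace (Z α) := BaireSpace.range_projection_of_dense (hY α) (T α)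
  have hZc (α : A₀) : SecondCountableTopology (Z α) := inferInstanceAs
    (SecondCountableTopology (range fun (f : Y α) (x : T α) => f.1 x))
  have : BaireSpace (∀ α, Z α) := BaireSpace.pi_of_secondCountable
  have hne (α) : Nonempty (Y α) := (hY α).nonempty.to_subtype
  have hlift (p : ∀ α, Z α) : (fun s : S => (p ⟨s.1.1, mem_image_of_mem _ s.2⟩).1 ⟨s.1.2, s.2⟩) ∈
      range fun (q : ∀ α, Y α) (s : S) => r q s := by
    choose f hf using fun α => (p α).2
    refine ⟨fun α => if hα : α ∈ A₀ then f ⟨α, hα⟩ else Classical.arbitrary _, ?_⟩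
    ext s
    have hs : s.1.1 ∈ A₀ := mem_image_of_mem _ s.2
    simp only [r, hs, dif_pos]
    exact congrFun (hf ⟨s.1.1, hs⟩) ⟨s.1.2, s.2⟩
  have hproj (z : range fun (q : ∀ α, Y α) (s : S) => r q s) (α : A₀) :
      (fun x : T α => z.1 ⟨⟨α, x⟩, x.2⟩) ∈ range fun (f : Y α) (x : T α) => f.1 x := by
    obtain ⟨_, q, rfl⟩ := z
    exact ⟨q α, rfl⟩
  let e : (∀ α, Z α) ≃ₜ range fun (q : ∀ α, Y α) (s : S) => r q s :=
    { toFun := fun p => ⟨_, hlift p⟩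
      invFun := fun z α => ⟨_, hproj z α⟩
      left_inv := fun p => rfl
      right_inv := fun z => rfl
      continuous_toFun := by
        refine Continuous.subtype_mk (continuous_pi fun s => ?_) _
        exact (continuous_apply _).comp (continuous_subtype_val.comp (continuous_apply _))
      continuous_invFun := by
        refine continuous_pi fun α => Continuous.subtype_mk (continuous_pi fun x => ?_) _
        exact (continuous_apply _).comp continuous_subtype_val }
  exact e.baireSpace

/-- The continuous functions on a Tychonoff space are dense in the space of all functions. -/
theorem dense_setOf_continuous {X : Type*} [TopologicalSpace X] [T35Space X] :
    Dense {f : X → ℝ | Continuous f} := by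
  classical
  rw [dense_iff_inter_open]
  rintro O hO ⟨g, hg⟩
  obtain ⟨F, u, hu, hsub⟩ := isOpen_pi_iff.1 hO g hg
  have hbump (x : X) : ∃ φ : X → ℝ, Continuous φ ∧ φ x = 1 ∧ ∀ y ∈ F, y ≠ x → φ y = 0 := by
    obtain ⟨f, hf, hfx, hfK⟩ := CompletelyRegularSpace.completely_regular x
      (F.erase x : Set X) (F.erase x).finite_toSet.isClosed (by simp)
    refine ⟨fun y => 1 - f y, by fun_prop, by simp [hfx], fun y hy hyx => ?_⟩
    simp [hfK (Finset.mem_coe.2 (Finset.mem_erase.2 ⟨hyx, hy⟩))]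
  choose φ hφc hφ1 hφ0 using hbump
  refine ⟨fun y => ∑ x ∈ F, g x * φ x y, hsub fun y hy => ?_,
    continuous_finsetSum _ fun x _ => continuous_const.mul (hφc x)⟩
  have : ∑ x ∈ F, g x * φ x y = g y := by
    rw [Finset.sum_eq_single_of_mem y hy fun x _ hxy => by rw [hφ0 x y hy hxy.symm, mul_zero],
      hφ1, mul_one]
  simpa only [this] using (hu y hy).2

theorem Continuous.baireOne {X : Type*} [TopologicalSpace X] {f : X → ℝ} (hf : Continuous f) :
    BaireOne f :=
  ⟨fun _ => f, fun _ => hf, fun _ => tendsto_const_nhds⟩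

/-- If `X α` are Tychonoff spaces such that each `B₁(X α)` is a Baire
space, then the product `∏_α B₁(X α)` is a Baire space. -/
theorem statement5 {A : Type*} {X : A → Type*} [∀ α, TopologicalSpace (X α)]
    [∀ α, T35Space (X α)]
    (h : ∀ α, BaireSpace {f : X α → ℝ // BaireOne f}) :
    BaireSpace (∀ α, {f : X α → ℝ // BaireOne f}) := by
  exact BaireSpace.pi_of_dense (Y := fun α => {f : X α → ℝ | BaireOne f})
    (fun _ => dense_setOf_continuous.mono fun _ hf => hf.baireOne) h
end

section
/- Let X be a Hausdorff topological space and let {F_i : i ∈ ℕ} be a pairwise disjoint family of Coz_δ-subsets of X such that ∪_{i∈ℕ} F_i is a Coz_δ-subset of X. Then the following are equivalent: (1) {F_i : i ∈ ℕ} is completely Coz_δ-additive; (2) there exists a pairwise disjoint family {D_i : i ∈ ℕ} of Zer_σ-subsets of X with F_i ⊆ D_i for each i ∈ ℕ. -/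
open Set Topology Filter

section ZeroSets

variable {X : Type*} [TopologicalSpace X]

theorem isZeroSet_empty : IsZeroSet (∅ : Set X) :=
  ⟨fun _ => 1, continuous_const, by ext; simp⟩

theorem isZeroSet_univ : IsZeroSet (univ : Set X) :=
  ⟨fun _ => 0, continuous_const, by ext; simp⟩

theorem IsZeroSet.inter {s t : Set X} (hs : IsZeroSet s) (ht : IsZeroSet t) :
    IsZeroSet (s ∩ t) := by
  obtain ⟨f, hf, rfl⟩ := hs
  obtain ⟨g, hg, rfl⟩ := ht
  refine ⟨fun x => |f x| + |g x|, by fun_prop, ?_⟩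
  ext x
  simp [add_eq_zero_iff_of_nonneg (abs_nonneg (f x)) (abs_nonneg (g x))]

theorem IsZeroSet.isZerSigma {s : Set X} (hs : IsZeroSet s) : IsZerSigma s :=
  ⟨fun _ => s, fun _ => hs, (iUnion_const s).symm⟩

theorem IsZeroSet.isZerSigma_compl {s : Set X} (hs : IsZeroSet s) : IsZerSigma sᶜ := by
  obtain ⟨f, hf, rfl⟩ := hs
  refine ⟨fun n => (fun x => max 0 (1 / ((n : ℝ) + 1) - |f x|)) ⁻¹' {0},
    fun n => ⟨_, by fun_prop, rfl⟩, ?_⟩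
  ext x
  simp only [mem_compl_iff, mem_preimage, mem_singleton_iff, mem_iUnion, max_eq_left_iff,
    sub_nonpos]
  constructor
  · intro hx
    obtain ⟨n, hn⟩ := exists_nat_one_div_lt (abs_pos.mpr hx)
    exact ⟨n, hn.le⟩
  · rintro ⟨n, hn⟩
    exact abs_pos.mp (Nat.one_div_pos_of_nat.trans_le hn)

theorem isZerSigma_compl {s : Set X} : IsZerSigma sᶜ ↔ IsCozDelta s := by
  constructor
  · rintro ⟨F, hF, h⟩
    refine ⟨fun n => (F n)ᶜ, fun n => by simpa [IsCozeroSet] using hF n, ?_⟩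
    rw [← compl_iUnion, ← h, compl_compl]
  · rintro ⟨F, hF, rfl⟩
    exact ⟨fun n => (F n)ᶜ, hF, compl_iInter F⟩

theorem IsZerSigma.iUnion {F : ℕ → Set X} (hF : ∀ n, IsZerSigma (F n)) :
    IsZerSigma (⋃ n, F n) := by
  choose G hG hFG using hF
  refine ⟨fun k => G k.unpair.1 k.unpair.2, fun k => hG _ _, ?_⟩
  rw [iUnion_unpair G]
  exact iUnion_congr hFG

theorem IsZerSigma.biUnion {F : ℕ → Set X} (hF : ∀ n, IsZerSigma (F n)) (S : Set ℕ) :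
    IsZerSigma (⋃ n ∈ S, F n) := by
  refine .iUnion fun n => ?_
  by_cases hn : n ∈ S
  · simpa [hn] using hF n
  · simpa [hn] using isZeroSet_empty.isZerSigma

theorem IsZerSigma.union {s t : Set X} (hs : IsZerSigma s) (ht : IsZerSigma t) :
    IsZerSigma (s ∪ t) := by
  have h : s ∪ t = ⋃ n : ℕ, if n = 0 then s else t := by
    ext x
    simp only [mem_union, mem_iUnion]
    constructor
    · rintro (h | h)
      exacts [⟨0, by simpa using h⟩, ⟨1, by simpa using h⟩]
    · rintro ⟨n, hn⟩
      split_ifs at hn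
      exacts [.inl hn, .inr hn]
  rw [h]
  refine .iUnion fun n => ?_
  split_ifs
  exacts [hs, ht]

theorem IsZerSigma.inter {s t : Set X} (hs : IsZerSigma s) (ht : IsZerSigma t) :
    IsZerSigma (s ∩ t) := by
  obtain ⟨F, hF, rfl⟩ := hs
  obtain ⟨G, hG, rfl⟩ := ht
  simp_rw [iUnion_inter, inter_iUnion]
  exact .iUnion fun n => .iUnion fun m => ((hF n).inter (hG m)).isZerSigma

theorem IsCozDelta.inter {s t : Set X} (hs : IsCozDelta s) (ht : IsCozDelta t) :
    IsCozDelta (s ∩ t) := by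
  rw [← isZerSigma_compl, compl_inter]
  exact (isZerSigma_compl.mpr hs).union (isZerSigma_compl.mpr ht)

theorem isZerSigma_forall_lt_notMem {Q : ℕ → Set X} (hQ : ∀ n, IsZerSigma (Q n)ᶜ) (n : ℕ) :
    IsZerSigma {x | ∀ m < n, x ∉ Q m} := by
  induction n with
  | zero => simpa using isZeroSet_univ.isZerSigma
  | succ n ih =>
    convert ih.inter (hQ n) using 1
    ext x
    exact Nat.forall_lt_succ_right

/-- Disjoint Coz_δ-sets are separated by a set that is Zer_σ together with its complement. -/
theorem IsCozDelta.exists_separation {A B : Set X} (hA : IsCozDelta A) (hB : IsCozDelta B)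
    (hAB : Disjoint A B) :
    ∃ E : Set X, IsZerSigma E ∧ IsZerSigma Eᶜ ∧ A ⊆ E ∧ Disjoint E B := by
  obtain ⟨P, hP, hAP⟩ := isZerSigma_compl.mpr hA
  obtain ⟨Q, hQ, hBQ⟩ := isZerSigma_compl.mpr hB
  have hPA : ∀ x, x ∈ A ↔ ∀ n, x ∉ P n := fun x => by
    simpa using (Set.ext_iff.mp hAP x).not
  have hQB : ∀ x, x ∈ B ↔ ∀ n, x ∉ Q n := fun x => by
    simpa using (Set.ext_iff.mp hBQ x).not
  have hE : (⋃ n, Q n ∩ {x | ∀ m < n + 1, x ∉ P m})ᶜ = ⋃ n, P n ∩ {x | ∀ m < n, x ∉ Q m} := by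
    ext x
    simp only [mem_compl_iff, mem_iUnion, mem_inter_iff, mem_ofPred_eq]
    constructor
    · intro hx
      have hex : ∃ n, x ∈ P n ∨ x ∈ Q n := by
        by_contra! h
        exact hAB.le_bot ⟨(hPA x).mpr fun n => (h n).1, (hQB x).mpr fun n => (h n).2⟩
      classical
      have hmin : ∀ m < Nat.find hex, x ∉ P m ∧ x ∉ Q m := fun m hm =>
        not_or.mp (Nat.find_min hex hm)
      by_cases hp : x ∈ P (Nat.find hex)
      · exact ⟨_, hp, fun m hm => (hmin m hm).2⟩
      · refine (hx ⟨_, (Nat.find_spec hex).resolve_left hp, fun m hm => ?_⟩).elim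
        rcases Nat.lt_succ_iff_lt_or_eq.mp hm with h | rfl
        exacts [(hmin m h).1, hp]
    · rintro ⟨n, hn, hn'⟩ ⟨k, hk, hk'⟩
      rcases lt_or_ge k n with h | h
      exacts [hn' k h hk, hk' n (Nat.lt_succ_of_le h) hn]
  refine ⟨⋃ n, Q n ∩ {x | ∀ m < n + 1, x ∉ P m}, ?_, ?_, fun x hx => ?_, ?_⟩
  · exact .iUnion fun n => (hQ n).isZerSigma.inter
      (isZerSigma_forall_lt_notMem (fun m => (hP m).isZerSigma_compl) _)
  · rw [hE]
    exact .iUnion fun n => (hP n).isZerSigma.inter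
      (isZerSigma_forall_lt_notMem (fun m => (hQ m).isZerSigma_compl) _)
  · by_contra h
    rw [← mem_compl_iff, hE] at h
    obtain ⟨n, hn, -⟩ := mem_iUnion.mp h
    exact (hPA x).mp hx n hn
  · rw [Set.disjoint_left]
    intro x hx hxB
    obtain ⟨n, hn, -⟩ := mem_iUnion.mp hx
    exact (hQB x).mp hxB n hn

end ZeroSets

/-- Let `X` be Hausdorff and `F : ℕ → Set X` a pairwise disjoint family
of Coz_δ-sets whose union is a Coz_δ-set. Then `F` is completely Coz_δ-additive iff
there is a pairwise disjoint family of Zer_σ-sets `D i ⊇ F i`. -/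
theorem statement9 {X : Type*} [TopologicalSpace X] [T2Space X]
    (F : ℕ → Set X) (hF : ∀ i, IsCozDelta (F i))
    (hdisj : Pairwise fun i j => Disjoint (F i) (F j))
    (hU : IsCozDelta (⋃ i, F i)) :
    CompletelyCozDeltaAdditive F ↔
      ∃ D : ℕ → Set X, (∀ i, IsZerSigma (D i)) ∧
        (Pairwise fun i j => Disjoint (D i) (D j)) ∧
        ∀ i, F i ⊆ D i := by
  constructor
  · rintro ⟨-, hadd⟩
    have hd : ∀ i, Disjoint (F i) (⋃ j ∈ ({i}ᶜ : Set ℕ), F j) := fun i =>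
      disjoint_iUnion₂_right.mpr fun j hj => hdisj (Ne.symm hj)
    choose E hE hEc hFE hEd using fun i => (hF i).exists_separation (hadd {i}ᶜ) (hd i)
    refine ⟨fun i => E i ∩ {x | ∀ j < i, x ∉ E j},
      fun i => (hE i).inter (isZerSigma_forall_lt_notMem hEc i), ?_, ?_⟩
    · intro i j hij
      rw [Set.disjoint_left]
      rintro x ⟨hi, hi'⟩ ⟨hj, hj'⟩
      rcases lt_or_gt_of_ne hij with h | h
      exacts [hj' i h hi, hi' j h hj]
    · exact fun i x hx => ⟨hFE i hx, fun j hj hxj =>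
        (hEd j).le_bot ⟨hxj, mem_biUnion (show i ∈ ({j}ᶜ : Set ℕ) from hj.ne') hx⟩⟩
  · rintro ⟨D, hD, hDd, hFD⟩
    refine ⟨hF, fun S => ?_⟩
    have h : ⋃ i ∈ S, F i = (⋃ i, F i) ∩ (⋃ i ∈ Sᶜ, D i)ᶜ := by
      ext x
      simp only [mem_iUnion, mem_inter_iff, mem_compl_iff, exists_prop, not_exists, not_and]
      constructor
      · rintro ⟨i, hi, hx⟩
        exact ⟨⟨i, hx⟩, fun j hj hxj =>
          (hDd (ne_of_mem_of_not_mem hi hj)).le_bot ⟨hFD i hx, hxj⟩⟩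
      · rintro ⟨⟨i, hx⟩, h⟩
        exact ⟨i, by_contra fun hi => h i hi (hFD i hx), hx⟩
    rw [h]
    refine hU.inter (isZerSigma_compl.mp ?_)
    rw [compl_compl]
    exact .biUnion hD _
end
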